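/- Let a, b be real with a > 0, b > 0 and a⁵ > 49·b⁵. Then the set of singular points of the affine quintic is finite and has exactly 49 elements. -/

import Mathlib

/-- The auxiliary cubic `φ_c(u,v,t) = (u+v)^3 + 3uv(u+v) + c t^3`. -/
noncomputable def phi (c u v t : ℂ) : ℂ := (u + v) ^ 3 + 3 * u * v * (u + v) + c * t ^ 3

/-- The quintic `F = xw φ_a(x,w,t) - yz φ_b(y,z,t)`. -/
noncomputable def F (a b : ℝ) (x y z w t : ℂ) : ℂ :=
  x * w * phi (a : ℂ) x w t - y * z * phi (b : ℂ) y z t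

/-- `(x,y,z,w)` is a singular point of the affine quintic `F(·,·,·,·,1) = 0`. -/
def IsSingularPoint (a b : ℝ) (x y z w : ℂ) : Prop :=
  F a b x y z w 1 = 0 ∧
  deriv (fun s => F a b s y z w 1) x = 0 ∧
  deriv (fun s => F a b x s z w 1) y = 0 ∧
  deriv (fun s => F a b x y s w 1) z = 0 ∧
  deriv (fun s => F a b x y z s 1) w = 0

/-- The partial derivative in `u` of `u v φ_c(u,v,1)`. -/
noncomputable def partialQuintic (c u v : ℂ) : ℂ :=
  v * phi c u v 1 + u * v * (3 * (u + v) ^ 2 + 3 * v * (u + v) + 3 * u * v)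

theorem hasDerivAt_mul_phi (c u v : ℂ) :
    HasDerivAt (fun s => s * v * phi c s v 1) (partialQuintic c u v) u := by
  have hs := hasDerivAt_id' u
  have hadd := hs.add_const v
  have hphi : HasDerivAt (fun s => phi c s v 1)
      (3 * (u + v) ^ 2 + 3 * v * (u + v) + 3 * u * v) u := by
    refine (((hadd.pow 3).add (((hs.const_mul 3).mul_const v).mul hadd)).add_const
      (c * 1 ^ 3)).congr_deriv ?_
    push_cast
    ring
  refine ((hs.mul_const v).mul hphi).congr_deriv ?_
  unfold partialQuintic
  ring

theorem phi_comm (c u v t : ℂ) : phi c u v t = phi c v u t := by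
  unfold phi
  ring

theorem isSingularPoint_iff (a b : ℝ) (x y z w : ℂ) :
    IsSingularPoint a b x y z w ↔
      (partialQuintic a x w = 0 ∧ partialQuintic a w x = 0) ∧
      (partialQuintic b y z = 0 ∧ partialQuintic b z y = 0) ∧
      x * w * phi a x w 1 = y * z * phi b y z 1 := by
  have hx : deriv (fun s => F a b s y z w 1) x = partialQuintic a x w :=
    ((hasDerivAt_mul_phi a x w).sub_const _).deriv
  have hy : deriv (fun s => F a b x s z w 1) y = -partialQuintic b y z :=
    ((hasDerivAt_mul_phi b y z).const_sub _).deriv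
  have hz : deriv (fun s => F a b x y s w 1) z = -partialQuintic b z y := by
    have h : (fun s => F a b x y s w 1) =
        fun s => x * w * phi a x w 1 - s * y * phi b s y 1 := by
      funext s
      rw [F, phi_comm b y s, mul_comm y s]
    rw [h]
    exact ((hasDerivAt_mul_phi b z y).const_sub _).deriv
  have hw : deriv (fun s => F a b x y z s 1) w = partialQuintic a w x := by
    have h : (fun s => F a b x y z s 1) =
        fun s => s * x * phi a s x 1 - y * z * phi b y z 1 := by
      funext s
      rw [F, phi_comm a x s, mul_comm x s]
    rw [h]
    exact ((hasDerivAt_mul_phi a w x).sub_const _).deriv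
  rw [IsSingularPoint, hx, hy, hz, hw, neg_eq_zero, neg_eq_zero, F, sub_eq_zero]
  tauto

/-- The critical points of `u v φ_c(u,v,1)` lying on the curve `u v φ_c(u,v,1) = 0`. -/
noncomputable def zeroCritical (c : ℂ) : Finset (ℂ × ℂ) :=
  insert (0, 0)
    ((Polynomial.nthRoots 3 (-c)).toFinset.image (fun s => ((0 : ℂ), s)) ∪
      (Polynomial.nthRoots 3 (-c)).toFinset.image (fun s => (s, (0 : ℂ))))

theorem mem_zeroCritical {c u v : ℂ} :
    (u, v) ∈ zeroCritical c ↔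
      (u = 0 ∧ v = 0) ∨ (u = 0 ∧ v ^ 3 = -c) ∨ (v = 0 ∧ u ^ 3 = -c) := by
  simp only [zeroCritical, Finset.mem_insert, Finset.mem_union, Finset.mem_image,
    Multiset.mem_toFinset, Polynomial.mem_nthRoots (show 0 < 3 by norm_num), Prod.mk.injEq]
  aesop

theorem card_zeroCritical {c : ℂ} (hc : c ≠ 0) : (zeroCritical c).card = 7 := by
  have hprim := Complex.isPrimitiveRoot_exp 3 (by norm_num)
  have hroots : (Polynomial.nthRoots 3 (-c)).toFinset.card = 3 := by
    rw [Multiset.toFinset_card_of_nodup (hprim.nthRoots_nodup (neg_ne_zero.mpr hc)),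
      hprim.card_nthRoots, if_pos]
    exact IsAlgClosed.exists_pow_nat_eq (-c) (by norm_num)
  have hne : ∀ s ∈ (Polynomial.nthRoots 3 (-c)).toFinset, s ≠ 0 := by
    rintro s hs rfl
    rw [Multiset.mem_toFinset, Polynomial.mem_nthRoots (by norm_num)] at hs
    exact hc (by simpa using hs.symm)
  rw [zeroCritical, Finset.card_insert_of_notMem, Finset.card_union_of_disjoint,
    Finset.card_image_of_injective _ (Prod.mk_right_injective 0),
    Finset.card_image_of_injective _ (Prod.mk_left_injective 0), hroots]
  · rw [Finset.disjoint_left]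
    simp only [Finset.mem_image]
    rintro _ ⟨s, hs, rfl⟩ ⟨t, -, h⟩
    exact hne s hs (congrArg Prod.snd h).symm
  · simp only [Finset.mem_union, Finset.mem_image, Prod.mk.injEq]
    rintro (⟨s, hs, -, h⟩ | ⟨s, hs, h, -⟩) <;> exact hne s hs h

theorem partialQuintic_eq_zero_of_mem {c u v : ℂ} (h : (u, v) ∈ zeroCritical c) :
    (partialQuintic c u v = 0 ∧ partialQuintic c v u = 0) ∧ u * v * phi c u v 1 = 0 := by
  unfold partialQuintic phi
  rcases mem_zeroCritical.mp h with ⟨rfl, rfl⟩ | ⟨rfl, h⟩ | ⟨rfl, h⟩ <;> grind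

/-- At a critical point of `u v φ_c(u,v,1)` the cube of the value is `0`, `-27 c⁵ / 5⁵` or
`27 c⁵ / (49 · 5⁵)`. -/
theorem criticalValue_cases {c u v : ℂ}
    (hu : partialQuintic c u v = 0) (hv : partialQuintic c v u = 0) :
    (u, v) ∈ zeroCritical c ∨
      (u * v * phi c u v 1) ^ 3 = -(27 * c ^ 5 / 3125) ∨
      (u * v * phi c u v 1) ^ 3 = 27 * c ^ 5 / 153125 := by
  rw [mem_zeroCritical]
  unfold partialQuintic phi at *
  by_cases huv : u = v
  · subst huv
    have h : u * (35 * u ^ 3 + c) = 0 := by linear_combination hu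
    rcases mul_eq_zero.mp h with h | h
    · exact Or.inl (Or.inl ⟨h, h⟩)
    · right; right
      obtain rfl : c = -35 * u ^ 3 := by linear_combination h
      ring
  · have hsub : v - u ≠ 0 := sub_ne_zero.mpr (Ne.symm huv)
    have hp : (u + v) ^ 3 + 6 * (u * v) * (u + v) + c = 0 := by
      apply (mul_eq_zero.mp _).resolve_left hsub
      linear_combination hu - hv
    have hs : u * (v * ((u + v) ^ 2 + u * v)) = 0 := by
      linear_combination (hu - v * hp) / 3
    rcases mul_eq_zero.mp hs with rfl | hs
    · exact Or.inl (Or.inr (Or.inl ⟨rfl, by linear_combination hp⟩))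
    rcases mul_eq_zero.mp hs with rfl | hs
    · exact Or.inl (Or.inr (Or.inr ⟨rfl, by linear_combination hp⟩))
    right; left
    have hq : u * v = -(u + v) ^ 2 := by linear_combination hs
    have hc : c = 5 * (u + v) ^ 3 := by linear_combination hp - 6 * (u + v) * hq
    have hval : u * v * ((u + v) ^ 3 + 3 * u * v * (u + v) + c * 1 ^ 3) = -3 * (u + v) ^ 5 := by
      rw [mul_assoc 3 u v, hq, hc]
      ring
    rw [hval, hc]
    ring

theorem isSingularPoint_iff_mem {a b : ℝ} (ha : 0 < a) (hb : 0 < b)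
    (hab : a ^ 5 ≠ b ^ 5) (x y z w : ℂ) :
    IsSingularPoint a b x y z w ↔ (x, w) ∈ zeroCritical a ∧ (y, z) ∈ zeroCritical b := by
  rw [isSingularPoint_iff]
  constructor
  · rintro ⟨⟨hx, hw⟩, ⟨hy, hz⟩, hval⟩
    have ha5 : 0 < a ^ 5 := by positivity
    have hb5 : 0 < b ^ 5 := by positivity
    have hzero : ∀ {r : ℝ} {q : ℂ}, q = 0 → q ^ 3 = (r : ℂ) → r = 0 := by
      rintro r q rfl h
      exact_mod_cast (h.symm.trans (by norm_num) : (r : ℂ) = 0)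
    have heq : ∀ {r s : ℝ}, (x * w * phi a x w 1) ^ 3 = (r : ℂ) →
        (y * z * phi b y z 1) ^ 3 = (s : ℂ) → r = s := by
      intro r s h h'
      rw [hval, h'] at h
      exact_mod_cast h.symm
    rcases criticalValue_cases hx hw with h | h | h <;>
      rcases criticalValue_cases hy hz with h' | h' | h'
    · exact ⟨h, h'⟩
    all_goals
      exfalso
      norm_cast at h h'
    · linarith [hzero (hval.symm.trans (partialQuintic_eq_zero_of_mem h).2) h']
    · linarith [hzero (hval.symm.trans (partialQuintic_eq_zero_of_mem h).2) h']
    · linarith [hzero (hval.trans (partialQuintic_eq_zero_of_mem h').2) h]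
    · exact hab (by linarith [heq h h'])
    · linarith [heq h h']
    · linarith [hzero (hval.trans (partialQuintic_eq_zero_of_mem h').2) h]
    · linarith [heq h h']
    · exact hab (by linarith [heq h h'])
  · rintro ⟨h, h'⟩
    obtain ⟨h1, h2⟩ := partialQuintic_eq_zero_of_mem h
    obtain ⟨h3, h4⟩ := partialQuintic_eq_zero_of_mem h'
    exact ⟨h1, h3, h2.trans h4.symm⟩

/-- If `a, b > 0` and `a⁵ > 49 b⁵`, the affine quintic has exactly 49 singular
points. -/
theorem singular_points_card_eq_49 (a b : ℝ) (ha : 0 < a) (hb : 0 < b)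
    (hab : a ^ 5 > 49 * b ^ 5) :
    {p : ℂ × ℂ × ℂ × ℂ | IsSingularPoint a b p.1 p.2.1 p.2.2.1 p.2.2.2}.Finite ∧
    {p : ℂ × ℂ × ℂ × ℂ | IsSingularPoint a b p.1 p.2.1 p.2.2.1 p.2.2.2}.ncard = 49 := by
  have hne : a ^ 5 ≠ b ^ 5 := by
    have : 0 < b ^ 5 := by positivity
    linarith
  let e : (ℂ × ℂ) × (ℂ × ℂ) → ℂ × ℂ × ℂ × ℂ := fun q => (q.1.1, q.2.1, q.2.2, q.1.2)
  have he : Function.Injective e := by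
    rintro ⟨⟨x, w⟩, y, z⟩ ⟨⟨x', w'⟩, y', z'⟩ h
    simp only [e, Prod.mk.injEq] at h ⊢
    tauto
  have hset : {p : ℂ × ℂ × ℂ × ℂ | IsSingularPoint a b p.1 p.2.1 p.2.2.1 p.2.2.2} =
      ((zeroCritical a ×ˢ zeroCritical b).image e : Finset _) := by
    ext ⟨x, y, z, w⟩
    simp only [Set.mem_ofPred_eq, isSingularPoint_iff_mem ha hb hne, Finset.mem_coe,
      Finset.mem_image, Finset.mem_product]
    constructor
    · intro h
      exact ⟨((x, w), (y, z)), h, rfl⟩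
    · rintro ⟨⟨⟨x', w'⟩, y', z'⟩, h, heq⟩
      simp only [e, Prod.mk.injEq] at heq
      obtain ⟨rfl, rfl, rfl, rfl⟩ := heq
      exact h
  rw [hset]
  refine ⟨Finset.finite_toSet _, ?_⟩
  rw [Set.ncard_coe_finset, Finset.card_image_of_injective _ he, Finset.card_product,
    card_zeroCritical (Complex.ofReal_ne_zero.mpr ha.ne'),
    card_zeroCritical (Complex.ofReal_ne_zero.mpr hb.ne')]
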